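/- Let m ≥ 1 be an integer and p > 1. Let K be a kernel on ℝⁿ×ℝⁿ (off the diagonal) satisfying: |K(x,y)| ≤ C_K|x−y|^{−n}; the smoothness estimate |K(x,y)−K(x',y)| + |K(y,x)−K(y,x')| ≤ ω(|x−x'|/|x−y|)·|x−y|^{−n} for |x−y| > 2|x−x'|, with ω : [0,1] → [0,∞), ω(t) → 0 as t → 0; and the non-degeneracy: there is c₀ > 0 such that for every y ∈ ℝⁿ, r > 0 there is x ∉ B(y,r) with |K(x,y)| ≥ c₀r^{−n}, and the same for the transposed kernel. Let λ, μ, η be weights, and assume there is C such that for every b ∈ BMO_η and every bounded compactly supported f, ‖χ_{ℝⁿ∖supp f} · (x ↦ ∫(b(x)−b(y))^m K(x,y)f(y)dy)‖_{L^p(λ)} ≤ C·‖b‖_{BMO_η}^m·‖f‖_{L^p(μ)}. Then there is a constant C' such that for every ball B = B(y₀,r) there is a disjoint ball B̃ = B(x₀,r) with dist(B,B̃) comparable to r, such that for every measurable f ≥ 0, (f_B)^p · ∫_{B̃} η^{pm}λ ≤ C'·∫_B f^p μ, where f_B = (1/|B|)∫_B f. -/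

import Mathlib

open MeasureTheory ENNReal Filter

noncomputable section

/-- A (half-open) cube in `ℝⁿ`. -/
structure Cube (n : ℕ) where
  corner : Fin n → ℝ
  side : ℝ
  side_pos : 0 < side

/-- The underlying set of a cube. -/
def Cube.set {n : ℕ} (Q : Cube n) : Set (Fin n → ℝ) :=
  Set.univ.pi fun i => Set.Ico (Q.corner i) (Q.corner i + Q.side)

/-- A weight: a non-negative, locally integrable function. -/
def IsWeight {n : ℕ} (w : (Fin n → ℝ) → ℝ) : Prop :=
  Measurable w ∧ (∀ x, 0 ≤ w x) ∧ LocallyIntegrable w volume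

/-- A sparse family of cubes with sparseness constant `α`. -/
def IsSparse {n : ℕ} (S : Set (Cube n)) (α : ℝ) : Prop :=
  ∃ E : Cube n → Set (Fin n → ℝ),
    (∀ Q ∈ S, E Q ⊆ Q.set ∧ MeasurableSet (E Q) ∧
      ENNReal.ofReal α * volume Q.set ≤ volume (E Q)) ∧
    S.Pairwise fun Q Q' => Disjoint (E Q) (E Q')

/-- The normalized Luxemburg norm `‖f‖_{φ,Q}` (with value `∞` if no λ works). -/
def luxNorm {n : ℕ} (φ : ℝ → ℝ) (Q : Set (Fin n → ℝ)) (f : (Fin n → ℝ) → ℝ) : ℝ≥0∞ :=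
  sInf {l : ℝ≥0∞ | ∃ c : ℝ, 0 < c ∧ l = ENNReal.ofReal c ∧
    (∫⁻ x in Q, ENNReal.ofReal (φ (|f x| / c))) ≤ volume Q}

/-- The sparse Orlicz operator `A_{L(log L)^m, S}`. -/
def sparseOrlicz {n : ℕ} (m : ℕ) (S : Set (Cube n)) (f : (Fin n → ℝ) → ℝ)
    (x : Fin n → ℝ) : ℝ≥0∞ :=
  ∑' Q : S, luxNorm (fun t => t * Real.log (Real.exp 1 + t) ^ m) Q.1.set f *
    Set.indicator Q.1.set (fun _ => (1 : ℝ≥0∞)) x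

/-- `L^p(w)` norm of an `ℝ≥0∞`-valued function. -/
def lpNormW {n : ℕ} (p : ℝ) (w : (Fin n → ℝ) → ℝ) (g : (Fin n → ℝ) → ℝ≥0∞) : ℝ≥0∞ :=
  (∫⁻ x, g x ^ p * ENNReal.ofReal (w x)) ^ (1 / p)

/-- `L^p(w)` norm of a real-valued function. -/
def lpNormR {n : ℕ} (p : ℝ) (w f : (Fin n → ℝ) → ℝ) : ℝ≥0∞ :=
  (∫⁻ x, ENNReal.ofReal |f x| ^ p * ENNReal.ofReal (w x)) ^ (1 / p)

/-- The two-weight bump constant `[g,h]_{A,B}`. -/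
def bump {n : ℕ} (A B : ℝ → ℝ) (g h : (Fin n → ℝ) → ℝ) : ℝ≥0∞ :=
  ⨆ Q : Cube n, luxNorm A Q.set g * luxNorm B Q.set h

/-- The logarithmic-bump Young function `t ↦ t^q (log(e+t))^a`. -/
def phiLog (q a : ℝ) : ℝ → ℝ := fun t => t ^ q * Real.log (Real.exp 1 + t) ^ a
/-- The size condition for a Calderón–Zygmund kernel. -/
def KernelSize {n : ℕ} (K : (Fin n → ℝ) → (Fin n → ℝ) → ℝ) (CK : ℝ) : Prop :=
  ∀ x y : Fin n → ℝ, x ≠ y → |K x y| ≤ CK / dist x y ^ n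

/-- The smoothness condition for a Calderón–Zygmund kernel with modulus `ω`. -/
def KernelSmooth {n : ℕ} (K : (Fin n → ℝ) → (Fin n → ℝ) → ℝ) (ω : ℝ → ℝ) : Prop :=
  ∀ x x' y : Fin n → ℝ, 2 * dist x x' < dist x y →
    |K x y - K x' y| + |K y x - K y x'| ≤ ω (dist x x' / dist x y) / dist x y ^ n

/-- Non-degeneracy of a kernel. -/
def KernelNonDeg {n : ℕ} (K : (Fin n → ℝ) → (Fin n → ℝ) → ℝ) (c₀ : ℝ) : Prop :=
  ∀ (y : Fin n → ℝ) (r : ℝ), 0 < r →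
    ∃ x : Fin n → ℝ, x ∉ Metric.ball y r ∧ c₀ / r ^ n ≤ |K x y|

/-- Average of a function over a cube. -/
def cubeAvg {n : ℕ} (f : (Fin n → ℝ) → ℝ) (Q : Cube n) : ℝ :=
  (∫ x in Q.set, f x) / (volume Q.set).toReal

/-- The `BMO` norm. -/
def bmoNorm {n : ℕ} (b : (Fin n → ℝ) → ℝ) : ℝ≥0∞ :=
  ⨆ Q : Cube n, (∫⁻ x in Q.set, ENNReal.ofReal |b x - cubeAvg b Q|) / volume Q.set

/-- The weighted `BMO_η` norm. -/
def bmoWNorm {n : ℕ} (η b : (Fin n → ℝ) → ℝ) : ℝ≥0∞ :=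
  ⨆ Q : Cube n, (∫⁻ x in Q.set, ENNReal.ofReal |b x - cubeAvg b Q|) /
    (∫⁻ x in Q.set, ENNReal.ofReal (η x))

/-- The `m`-th iterated commutator of the operator with kernel `K` and of `b`,
given by an absolutely convergent integral off the support of `f`. -/
def commFn {n : ℕ} (m : ℕ) (K : (Fin n → ℝ) → (Fin n → ℝ) → ℝ)
    (b f : (Fin n → ℝ) → ℝ) (x : Fin n → ℝ) : ℝ :=
  ∫ y, (b x - b y) ^ m * K x y * f y

/-- The double `2Q` of a cube: concentric with twice the side length. -/
def Cube.double {n : ℕ} (Q : Cube n) : Cube n :=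
  ⟨fun i => Q.corner i - Q.side / 2, 2 * Q.side, by have := Q.side_pos; linarith⟩

/-- A doubling weight: `u(2Q) ≤ c·u(Q)` for all cubes `Q`. -/
def IsDoublingWeight {n : ℕ} (u : (Fin n → ℝ) → ℝ) : Prop :=
  ∃ c : ℝ, ∀ Q : Cube n,
    (∫⁻ x in Q.double.set, ENNReal.ofReal (u x)) ≤
      ENNReal.ofReal c * ∫⁻ x in Q.set, ENNReal.ofReal (u x)

/-- The weak `L^{p,∞}(u)` norm. -/
def weakLpNorm {n : ℕ} (p : ℝ) (u : (Fin n → ℝ) → ℝ) (g : (Fin n → ℝ) → ℝ) : ℝ≥0∞ :=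
  ⨆ (t : ℝ) (_ : 0 < t),
    ENNReal.ofReal t * (∫⁻ x in {x | t < |g x|}, ENNReal.ofReal (u x)) ^ (1 / p)

/-- Average of a function over a ball. -/
def ballAvg {n : ℕ} (f : (Fin n → ℝ) → ℝ) (y : Fin n → ℝ) (r : ℝ) : ℝ :=
  (∫ x in Metric.ball y r, f x) / (volume (Metric.ball y r)).toReal

theorem Cube.volume_set_ne_top {n : ℕ} (Q : Cube n) : volume Q.set ≠ ⊤ := by
  simp [Cube.set, Real.volume_pi_Ico]

theorem Cube.volume_mul_ofReal_abs_cubeAvg_le {n : ℕ} (Q : Cube n) (b : (Fin n → ℝ) → ℝ) :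
    volume Q.set * ENNReal.ofReal |cubeAvg b Q| ≤ ∫⁻ x in Q.set, ENNReal.ofReal |b x| := by
  have h : volume Q.set * ENNReal.ofReal |cubeAvg b Q| ≤ ‖∫ x in Q.set, b x‖ₑ := by
    rw [Real.enorm_eq_ofReal_abs, ← ENNReal.ofReal_toReal Q.volume_set_ne_top,
      ← ENNReal.ofReal_mul ENNReal.toReal_nonneg, cubeAvg, abs_div, abs_of_nonneg
        (ENNReal.toReal_nonneg (a := volume Q.set))]
    refine ENNReal.ofReal_le_ofReal ?_
    rcases (ENNReal.toReal_nonneg (a := volume Q.set)).eq_or_lt with h0 | h0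
    · simp [← h0]
    · rw [mul_div_cancel₀ _ h0.ne']
  refine h.trans ((enorm_integral_le_lintegral_enorm _).trans_eq ?_)
  simp only [Real.enorm_eq_ofReal_abs]

/-- A function dominated by the weight `η` has `BMO_η` norm at most `2`. -/
theorem bmoWNorm_le_two {n : ℕ} {η b : (Fin n → ℝ) → ℝ} (h : ∀ x, |b x| ≤ η x) :
    bmoWNorm η b ≤ 2 := by
  refine iSup_le fun Q => ENNReal.div_le_of_le_mul ?_
  have hb : ∫⁻ x in Q.set, ENNReal.ofReal |b x| ≤ ∫⁻ x in Q.set, ENNReal.ofReal (η x) :=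
    lintegral_mono fun x => ENNReal.ofReal_le_ofReal (h x)
  calc ∫⁻ x in Q.set, ENNReal.ofReal |b x - cubeAvg b Q|
      ≤ ∫⁻ x in Q.set, (ENNReal.ofReal |b x| + ENNReal.ofReal |cubeAvg b Q|) := by
        refine lintegral_mono fun x => ?_
        rw [← ENNReal.ofReal_add (abs_nonneg _) (abs_nonneg _)]
        exact ENNReal.ofReal_le_ofReal (abs_sub _ _)
    _ = (∫⁻ x in Q.set, ENNReal.ofReal |b x|) +
          volume Q.set * ENNReal.ofReal |cubeAvg b Q| := by
        rw [lintegral_add_right _ measurable_const, setLIntegral_const, mul_comm]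
    _ ≤ 2 * ∫⁻ x in Q.set, ENNReal.ofReal (η x) := by
        rw [two_mul]
        exact add_le_add hb ((Q.volume_mul_ofReal_abs_cubeAvg_le b).trans hb)

/-- Small relative displacements change a smooth kernel by a small relative amount. -/
theorem KernelSmooth.exists_forall_abs_sub_le {n : ℕ} {K : (Fin n → ℝ) → (Fin n → ℝ) → ℝ}
    {ω : ℝ → ℝ} (hK : KernelSmooth K ω)
    (hω : Tendsto ω (nhdsWithin 0 (Set.Ioi 0)) (nhds 0)) {ε : ℝ} (hε : 0 < ε) :
    ∃ δ : ℝ, 0 < δ ∧ ∀ x x' y : Fin n → ℝ, dist x x' < δ * dist x y →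
      |K x y - K x' y| ≤ ε / dist x y ^ n ∧ |K y x - K y x'| ≤ ε / dist x y ^ n := by
  obtain ⟨δ, hδ, h⟩ := Metric.tendsto_nhdsWithin_nhds.1 hω ε hε
  refine ⟨min δ (1 / 2), by positivity, fun x x' y hxy => ?_⟩
  rcases eq_or_ne x x' with rfl | hne
  · simp only [sub_self, abs_zero, and_self]
    positivity
  have hd : 0 < dist x y := by
    by_contra hcon
    have h0 : dist x y = 0 := le_antisymm (not_lt.1 hcon) dist_nonneg
    rw [h0, mul_zero] at hxy
    exact absurd hxy (not_lt.2 dist_nonneg)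
  have hx : 0 < dist x x' := dist_pos.2 hne
  have h1 : dist x x' < δ * dist x y :=
    hxy.trans_le (mul_le_mul_of_nonneg_right (min_le_left _ _) hd.le)
  have h2 : dist x x' < 1 / 2 * dist x y :=
    hxy.trans_le (mul_le_mul_of_nonneg_right (min_le_right _ _) hd.le)
  have h3 := hK x x' y (by linarith)
  have h4 : ω (dist x x' / dist x y) < ε := by
    have := h (x := dist x x' / dist x y) (div_pos hx hd) (by
      rw [Real.dist_eq, sub_zero, abs_of_pos (div_pos hx hd)]
      exact (div_lt_iff₀ hd).2 h1)
    rw [Real.dist_eq, sub_zero] at this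
    exact (le_abs_self _).trans_lt this
  have h5 : ω (dist x x' / dist x y) / dist x y ^ n ≤ ε / dist x y ^ n := by gcongr
  constructor <;> linarith [abs_nonneg (K x y - K x' y), abs_nonneg (K y x - K y x')]

theorem KernelSmooth.continuousOn_right {n : ℕ} {K : (Fin n → ℝ) → (Fin n → ℝ) → ℝ}
    {ω : ℝ → ℝ} (hK : KernelSmooth K ω)
    (hω : Tendsto ω (nhdsWithin 0 (Set.Ioi 0)) (nhds 0)) (x : Fin n → ℝ) :
    ContinuousOn (K x) {x}ᶜ := by
  refine fun y hy => ContinuousAt.continuousWithinAt (Metric.continuousAt_iff.2 fun e he => ?_)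
  have hd : 0 < dist y x := dist_pos.2 hy
  obtain ⟨δ, hδ, h⟩ := hK.exists_forall_abs_sub_le hω
    (ε := e / 2 * dist y x ^ n) (by positivity)
  refine ⟨δ * dist y x, by positivity, fun y' hy' => ?_⟩
  have h1 := (h y y' x (by rwa [dist_comm])).2
  rw [mul_div_cancel_right₀ _ (by positivity)] at h1
  rw [Real.dist_eq, abs_sub_comm]
  linarith

/-- A smooth non-degenerate kernel has constant sign and is large on the product of a given ball
with a suitable ball of the same radius, at a comparable distance. -/
theorem KernelNonDeg.exists_ball_lower_bound {n : ℕ} (hn : n ≠ 0)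
    {K : (Fin n → ℝ) → (Fin n → ℝ) → ℝ} {CK : ℝ} (hsize : KernelSize K CK)
    {ω : ℝ → ℝ} (hω : Tendsto ω (nhdsWithin 0 (Set.Ioi 0)) (nhds 0))
    (hsmooth : KernelSmooth K ω) {c₀ : ℝ} (hc₀ : 0 < c₀) (hnd : KernelNonDeg K c₀) :
    ∃ D κ : ℝ, 0 < D ∧ 0 < κ ∧ ∀ (y₀ : Fin n → ℝ) (r : ℝ), 0 < r →
      ∃ x₀ : Fin n → ℝ, 3 * r ≤ dist y₀ x₀ ∧ dist y₀ x₀ ≤ D * r ∧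
        ∃ σ : ℝ, |σ| = 1 ∧ ∀ x ∈ Metric.ball x₀ r, ∀ y ∈ Metric.ball y₀ r,
          κ / r ^ n ≤ σ * K x y := by
  obtain ⟨δ, hδ, h⟩ := hsmooth.exists_forall_abs_sub_le hω (ε := c₀ / 4 / 2 ^ n) (by positivity)
  obtain ⟨A, hA3, hAδ⟩ : ∃ A : ℝ, 3 ≤ A ∧ 1 < δ * (A - 1) := by
    have hδ' : 0 < 1 / δ := by positivity
    refine ⟨3 + 1 / δ, by linarith, ?_⟩
    have : δ * (3 + 1 / δ - 1) = 2 * δ + 1 := by field_simp; ring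
    linarith
  have hA : 0 < A := by linarith
  have hT : 1 ≤ max 1 (CK / c₀) := le_max_left _ _
  refine ⟨max 1 (CK / c₀) * A, c₀ / 2 / A ^ n, by positivity, by positivity,
    fun y₀ r hr => ?_⟩
  obtain ⟨x₀, hx₀, hKx₀⟩ := hnd y₀ (A * r) (by positivity)
  have hd : A * r ≤ dist x₀ y₀ := not_lt.1 hx₀
  have hAr : 0 < A * r := by positivity
  have hd0 : 0 < dist x₀ y₀ := hAr.trans_le hd
  refine ⟨x₀, ?_, ?_, SignType.sign (K x₀ y₀), ?_, fun x hx y hy => ?_⟩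
  · rw [dist_comm]
    nlinarith
  · rw [dist_comm]
    have h1 := hKx₀.trans (hsize x₀ y₀ (dist_pos.1 hd0))
    rw [div_le_div_iff₀ (by positivity) (by positivity)] at h1
    have h2 : dist x₀ y₀ ^ n ≤ CK / c₀ * (A * r) ^ n := by
      rw [div_mul_eq_mul_div, le_div_iff₀ hc₀]
      linarith
    refine le_of_pow_le_pow_left₀ hn (by positivity) (h2.trans ?_)
    rw [mul_assoc, mul_pow (max 1 (CK / c₀))]
    gcongr
    exact (le_max_right _ _).trans (le_self_pow₀ hT hn)
  · have : K x₀ y₀ ≠ 0 := by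
      intro h0
      rw [h0, abs_zero] at hKx₀
      exact absurd hKx₀ (not_le.2 (by positivity))
    rcases this.lt_or_gt with h0 | h0 <;> simp [h0]
  · rw [Metric.mem_ball] at hx hy
    have hdy : (A - 1) * r ≤ dist x₀ y := by
      have := dist_triangle x₀ y y₀
      linarith
    have hrδ : r < δ * ((A - 1) * r) := by nlinarith
    have key : ∀ d : ℝ, (A - 1) * r ≤ d →
        c₀ / 4 / 2 ^ n / d ^ n ≤ c₀ / 4 / (A * r) ^ n := by
      intro d hd
      rw [div_div _ (2 ^ n : ℝ), ← mul_pow]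
      exact div_le_div_of_nonneg_left (by positivity) (by positivity)
        (pow_le_pow_left₀ hAr.le (by nlinarith) n)
    have h1 := ((h x₀ x y (by
      rw [dist_comm]
      exact hx.trans (hrδ.trans_le (by gcongr)))).1).trans (key _ hdy)
    have hdx : (A - 1) * r ≤ dist y₀ x₀ := by rw [dist_comm]; linarith
    have h2 := ((h y₀ y x₀ (by
      rw [dist_comm]
      exact hy.trans (hrδ.trans_le (by gcongr)))).2).trans (key _ hdx)
    have h3 : c₀ / 2 / A ^ n / r ^ n = 2 * (c₀ / 4 / (A * r) ^ n) := by
      rw [mul_pow]; field_simp; ring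
    have h4 : c₀ / (A * r) ^ n = 4 * (c₀ / 4 / (A * r) ^ n) := by field_simp
    rw [h3]
    rw [h4] at hKx₀
    rw [abs_le] at h1 h2
    have hp : 0 < c₀ / 4 / (A * r) ^ n := by positivity
    rcases lt_trichotomy (K x₀ y₀) 0 with h0 | h0 | h0
    · rw [abs_of_neg h0] at hKx₀
      simp only [h0, sign_neg, SignType.coe_neg_one]
      linarith
    · rw [h0, abs_zero] at hKx₀
      linarith
    · rw [abs_of_pos h0] at hKx₀
      simp only [h0, sign_pos, SignType.coe_one]
      linarith

/-- The two-weight bound for the commutator, tested on a bounded function supported in a ball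
and on the weight restricted to another ball away from it. -/
theorem testing_of_bounded {n m : ℕ} {p : ℝ} (hp : 0 < p)
    {K : (Fin n → ℝ) → (Fin n → ℝ) → ℝ} {lam mu eta : (Fin n → ℝ) → ℝ}
    (heta : IsWeight eta) {C : ℝ}
    (hbound : ∀ b : (Fin n → ℝ) → ℝ, LocallyIntegrable b volume →
      bmoWNorm eta b < ⊤ →
      ∀ f : (Fin n → ℝ) → ℝ, Measurable f → (∃ M : ℝ, ∀ x, |f x| ≤ M) →
        HasCompactSupport f →
        lpNormR p lam (Set.indicator (tsupport f)ᶜ (commFn m K b f)) ≤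
          ENNReal.ofReal C * bmoWNorm eta b ^ m * lpNormR p mu f)
    {x₀ y₀ : Fin n → ℝ} {r σ c : ℝ}
    (hdisj : Disjoint (Metric.closedBall y₀ r) (Metric.ball x₀ r)) (hσ : |σ| = 1)
    (hKint : ∀ x ∈ Metric.ball x₀ r, IntegrableOn (K x) (Metric.ball y₀ r))
    (hKlow : ∀ x ∈ Metric.ball x₀ r, ∀ y ∈ Metric.ball y₀ r, c ≤ σ * K x y)
    {g : (Fin n → ℝ) → ℝ} (hg : Measurable g) (hg0 : ∀ x, 0 ≤ g x) {M : ℝ}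
    (hgM : ∀ x, g x ≤ M) :
    ENNReal.ofReal (c * ∫ y in Metric.ball y₀ r, g y) ^ p *
        (∫⁻ x in Metric.ball x₀ r, ENNReal.ofReal (eta x ^ (p * (m : ℝ)) * lam x)) ≤
      (ENNReal.ofReal C * 2 ^ m) ^ p *
        ∫⁻ x in Metric.ball y₀ r, ENNReal.ofReal (g x ^ p * mu x) := by
  set B := Metric.ball y₀ r with hB
  set B' := Metric.ball x₀ r with hB'
  have hBm : MeasurableSet B := measurableSet_ball
  have hB'm : MeasurableSet B' := measurableSet_ball
  set f := B.indicator g with hf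
  set b := B'.indicator eta with hb
  have hts : tsupport f ⊆ Metric.closedBall y₀ r :=
    closure_minimal ((Set.support_indicator_subset).trans Metric.ball_subset_closedBall)
      Metric.isClosed_closedBall
  have hbmo : bmoWNorm eta b ≤ 2 := bmoWNorm_le_two fun x => by
    by_cases hx : x ∈ B' <;> simp [hb, hx, heta.2.1 x, abs_of_nonneg]
  have hgi : IntegrableOn g B := by
    refine Measure.integrableOn_of_bounded (M := M) measure_ball_lt_top.ne
      hg.aestronglyMeasurable (ae_of_all _ fun x => ?_)
    rw [Real.norm_of_nonneg (hg0 x)]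
    exact hgM x
  have hcomm : ∀ x ∈ B', eta x ^ m * (c * ∫ y in B, g y) ≤ |commFn m K b f x| := by
    intro x hx
    have h1 : commFn m K b f x = eta x ^ m * ∫ y in B, K x y * g y := by
      rw [commFn, ← integral_const_mul, ← integral_indicator hBm]
      refine integral_congr_ae (ae_of_all _ fun y => ?_)
      by_cases hy : y ∈ B
      · have hy' : y ∉ B' := fun h =>
          Set.disjoint_left.1 hdisj (Metric.ball_subset_closedBall hy) h
        simp [hb, hf, hx, hy, hy', mul_assoc]
      · simp [hf, hy]
    rw [h1, abs_mul, abs_of_nonneg (pow_nonneg (heta.2.1 x) m)]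
    refine mul_le_mul_of_nonneg_left ?_ (pow_nonneg (heta.2.1 x) m)
    have hKg : IntegrableOn (fun y => K x y * g y) B := by
      refine Integrable.mul_bdd (c := M) (hKint x hx) hg.aestronglyMeasurable
        (ae_of_all _ fun y => ?_)
      rw [Real.norm_of_nonneg (hg0 y)]
      exact hgM y
    calc c * ∫ y in B, g y = ∫ y in B, c * g y := (integral_const_mul _ _).symm
      _ ≤ ∫ y in B, σ * (K x y * g y) := by
          refine setIntegral_mono_on (hgi.const_mul c) (hKg.const_mul σ) hBm fun y hy => ?_
          rw [← mul_assoc]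
          exact mul_le_mul_of_nonneg_right (hKlow x hx y hy) (hg0 y)
      _ = σ * ∫ y in B, K x y * g y := integral_const_mul _ _
      _ ≤ |∫ y in B, K x y * g y| := by
          refine (le_abs_self _).trans_eq ?_
          rw [abs_mul, hσ, one_mul]
  have hmain := hbound b (heta.2.2.indicator hB'm) (hbmo.trans_lt (by simp)) f
    (hg.indicator hBm)
    ⟨M, fun x => by
      by_cases hx : x ∈ B
      · simpa [hf, hx, abs_of_nonneg (hg0 x)] using hgM x
      · simpa [hf, hx] using (hg0 x).trans (hgM x)⟩
    ((isCompact_closedBall y₀ r).of_isClosed_subset (isClosed_tsupport f) hts)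
  have hcancel : ∀ X : ℝ≥0∞, (X ^ (1 / p)) ^ p = X := fun X => by
    rw [← ENNReal.rpow_mul, one_div_mul_cancel hp.ne', ENNReal.rpow_one]
  have hright : lpNormR p mu f ^ p = ∫⁻ x in B, ENNReal.ofReal (g x ^ p * mu x) := by
    rw [lpNormR, hcancel, ← lintegral_indicator hBm]
    refine lintegral_congr fun x => ?_
    by_cases hx : x ∈ B
    · simp only [hf, hx, Set.indicator_of_mem]
      rw [abs_of_nonneg (hg0 x), ENNReal.ofReal_rpow_of_nonneg (hg0 x) hp.le,
        ENNReal.ofReal_mul (Real.rpow_nonneg (hg0 x) p)]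
    · simp [hf, hx, hp]
  have hleft : ENNReal.ofReal (c * ∫ y in B, g y) ^ p *
      (∫⁻ x in B', ENNReal.ofReal (eta x ^ (p * (m : ℝ)) * lam x)) ≤
      lpNormR p lam (Set.indicator (tsupport f)ᶜ (commFn m K b f)) ^ p := by
    rw [lpNormR, hcancel, ← lintegral_const_mul' _ _
      (ENNReal.rpow_ne_top_of_nonneg hp.le ENNReal.ofReal_ne_top)]
    refine le_trans (setLIntegral_mono' hB'm fun x hx => ?_) (setLIntegral_le_lintegral B' _)
    have hxs : x ∈ (tsupport f)ᶜ := fun h => Set.disjoint_left.1 hdisj (hts h) hx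
    have he := heta.2.1 x
    rw [Set.indicator_of_mem hxs, ENNReal.ofReal_mul (Real.rpow_nonneg he _), ← mul_assoc,
      mul_comm p, Real.rpow_mul he, Real.rpow_natCast,
      ← ENNReal.ofReal_rpow_of_nonneg (pow_nonneg he m) hp.le,
      ← ENNReal.mul_rpow_of_nonneg _ _ hp.le, mul_comm (ENNReal.ofReal (c * _)),
      ← ENNReal.ofReal_mul (pow_nonneg he m)]
    gcongr
    exact hcomm x hx
  calc _ ≤ _ := hleft
    _ ≤ (ENNReal.ofReal C * bmoWNorm eta b ^ m * lpNormR p mu f) ^ p :=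
        ENNReal.rpow_le_rpow hmain hp.le
    _ ≤ (ENNReal.ofReal C * 2 ^ m * lpNormR p mu f) ^ p := by gcongr
    _ = _ := by rw [ENNReal.mul_rpow_of_nonneg _ _ hp.le, hright]

theorem tendsto_setIntegral_min_natCast {α : Type*} [MeasurableSpace α] {ν : Measure α}
    {s : Set α} {f : α → ℝ} (hf : Measurable f) (hf0 : ∀ x, 0 ≤ f x)
    (hfi : IntegrableOn f s ν) :
    Tendsto (fun k : ℕ => ∫ x in s, min (f x) k ∂ν) atTop (nhds (∫ x in s, f x ∂ν)) := by
  refine tendsto_integral_of_dominated_convergence f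
    (fun k => (hf.min measurable_const).aestronglyMeasurable) hfi
    (fun k => ae_of_all _ fun x => ?_) (ae_of_all _ fun x => ?_)
  · rw [Real.norm_of_nonneg (le_min (hf0 x) k.cast_nonneg)]
    exact min_le_left _ _
  · refine tendsto_const_nhds.congr' ?_
    filter_upwards [eventually_ge_atTop ⌈f x⌉₊] with k hk
    exact (min_eq_left (Nat.ceil_le.1 hk)).symm

/-- **Proposition (testing condition necessary for the two-weight bound on `T_b^m`,
`b ∈ BMO_η`).** -/
theorem ball_testing_necessary (n : ℕ) (m : ℕ) (hm : 1 ≤ m) (p : ℝ) (hp : 1 < p)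
    (K : (Fin n → ℝ) → (Fin n → ℝ) → ℝ) (CK : ℝ) (hsize : KernelSize K CK)
    (ω : ℝ → ℝ) (hω0 : ∀ t, 0 ≤ ω t)
    (hωlim : Tendsto ω (nhdsWithin 0 (Set.Ioi 0)) (nhds 0))
    (hsmooth : KernelSmooth K ω)
    (c₀ : ℝ) (hc₀ : 0 < c₀) (hnd : KernelNonDeg K c₀)
    (hnd' : KernelNonDeg (fun x y => K y x) c₀)
    (lam mu eta : (Fin n → ℝ) → ℝ)
    (hlam : IsWeight lam) (hmu : IsWeight mu) (heta : IsWeight eta)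
    (C : ℝ)
    (hbound : ∀ b : (Fin n → ℝ) → ℝ, LocallyIntegrable b volume →
      bmoWNorm eta b < ⊤ →
      ∀ f : (Fin n → ℝ) → ℝ, Measurable f → (∃ M : ℝ, ∀ x, |f x| ≤ M) →
        HasCompactSupport f →
        lpNormR p lam (Set.indicator (tsupport f)ᶜ (commFn m K b f)) ≤
          ENNReal.ofReal C * bmoWNorm eta b ^ m * lpNormR p mu f) :
    ∃ c₁ c₂ C' : ℝ, 0 < c₁ ∧ 0 < c₂ ∧ 0 < C' ∧
      ∀ (y₀ : Fin n → ℝ) (r : ℝ), 0 < r →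
        ∃ x₀ : Fin n → ℝ,
          Disjoint (Metric.ball y₀ r) (Metric.ball x₀ r) ∧
          c₁ * r ≤ dist y₀ x₀ ∧ dist y₀ x₀ ≤ c₂ * r ∧
          ∀ f : (Fin n → ℝ) → ℝ, Measurable f → (∀ x, 0 ≤ f x) →
            ENNReal.ofReal (ballAvg f y₀ r) ^ p *
                (∫⁻ x in Metric.ball x₀ r,
                  ENNReal.ofReal (eta x ^ (p * (m : ℝ)) * lam x)) ≤
              ENNReal.ofReal C' *
                ∫⁻ x in Metric.ball y₀ r, ENNReal.ofReal (f x ^ p * mu x) := by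
  rcases eq_or_ne n 0 with rfl | hn
  · obtain ⟨x, hx, -⟩ := hnd 0 1 one_pos
    exact absurd (Metric.mem_ball.2 (by simp [Subsingleton.elim x 0])) hx
  have hp0 : 0 < p := by linarith
  obtain ⟨D, κ, hD, hκ, hball⟩ :=
    hnd.exists_ball_lower_bound hn hsize hωlim hsmooth hc₀
  have hC1 : 0 < max C 1 := by positivity
  refine ⟨3, D, (max C 1 * 2 ^ m / (κ * 2 ^ n)) ^ p, by norm_num, hD, by positivity,
    fun y₀ r hr => ?_⟩
  obtain ⟨x₀, hfar, hnear, σ, hσ, hlow⟩ := hball y₀ r hr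
  have hdisj : Disjoint (Metric.closedBall y₀ r) (Metric.ball x₀ r) :=
    Metric.closedBall_disjoint_ball (by linarith)
  refine ⟨x₀, hdisj.mono_left Metric.ball_subset_closedBall, hfar, hnear,
    fun f hf hf0 => ?_⟩
  have hKint : ∀ x ∈ Metric.ball x₀ r, IntegrableOn (K x) (Metric.ball y₀ r) := by
    intro x hx
    refine ((hsmooth.continuousOn_right hωlim x).mono ?_).integrableOn_compact
      (isCompact_closedBall y₀ r) |>.mono_set Metric.ball_subset_closedBall
    intro y hy hyx
    rw [Set.mem_singleton_iff.1 hyx] at hy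
    exact Set.disjoint_left.1 hdisj hy hx
  have havg : ∀ g : (Fin n → ℝ) → ℝ,
      κ / r ^ n * ∫ y in Metric.ball y₀ r, g y = κ * 2 ^ n * ballAvg g y₀ r := by
    intro g
    rw [ballAvg, Real.volume_pi_ball _ hr, ENNReal.toReal_ofReal (by positivity),
      Fintype.card_fin, mul_pow]
    field_simp
  set I := ∫⁻ x in Metric.ball x₀ r, ENNReal.ofReal (eta x ^ (p * (m : ℝ)) * lam x)
  set J := ∫⁻ x in Metric.ball y₀ r, ENNReal.ofReal (f x ^ p * mu x)
  have hmin : ∀ k : ℕ, ENNReal.ofReal (ballAvg (fun x => min (f x) k) y₀ r) ^ p * I ≤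
      ENNReal.ofReal ((max C 1 * 2 ^ m / (κ * 2 ^ n)) ^ p) * J := by
    intro k
    have h := testing_of_bounded (g := fun x => min (f x) k) hp0 heta hbound
      (c := κ / r ^ n) hdisj hσ hKint hlow (hf.min measurable_const)
      (fun x => le_min (hf0 x) k.cast_nonneg) (fun x => min_le_right _ _)
    rw [havg, ENNReal.ofReal_mul (by positivity), ENNReal.mul_rpow_of_nonneg _ _ hp0.le] at h
    have hJ : ∫⁻ x in Metric.ball y₀ r, ENNReal.ofReal (min (f x) k ^ p * mu x) ≤ J := by
      refine lintegral_mono fun x => ENNReal.ofReal_le_ofReal ?_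
      exact mul_le_mul_of_nonneg_right (Real.rpow_le_rpow
        (le_min (hf0 x) k.cast_nonneg) (min_le_left _ _) hp0.le) (hmu.2.1 x)
    have hCm : ENNReal.ofReal C * 2 ^ m ≤ ENNReal.ofReal (max C 1 * 2 ^ m) := by
      rw [ENNReal.ofReal_mul hC1.le, ENNReal.ofReal_pow (by norm_num), ENNReal.ofReal_ofNat]
      gcongr
      exact le_max_left _ _
    have hκn : 0 < κ * 2 ^ n := by positivity
    rw [← ENNReal.ofReal_rpow_of_nonneg (by positivity) hp0.le, ENNReal.ofReal_div_of_pos hκn,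
      ENNReal.div_rpow_of_nonneg _ _ hp0.le, ENNReal.mul_comm_div,
      ← mul_div_assoc, ENNReal.le_div_iff_mul_le (Or.inl (by positivity))
        (Or.inl (ENNReal.rpow_ne_top_of_nonneg hp0.le ENNReal.ofReal_ne_top)),
      mul_comm, ← mul_assoc]
    refine h.trans ?_
    gcongr
  by_cases hfi : IntegrableOn f (Metric.ball y₀ r)
  · have hlim : Tendsto (fun k : ℕ => ENNReal.ofReal (ballAvg (fun x => min (f x) k) y₀ r) ^ p)
        atTop (nhds (ENNReal.ofReal (ballAvg f y₀ r) ^ p)) :=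
      (ENNReal.continuous_rpow_const.tendsto _).comp (ENNReal.tendsto_ofReal
        ((tendsto_setIntegral_min_natCast hf hf0 hfi).div_const _))
    rcases eq_or_ne (ENNReal.ofReal (ballAvg f y₀ r) ^ p) 0 with h0 | h0
    · simp [h0]
    · exact le_of_tendsto' (ENNReal.Tendsto.mul_const hlim (Or.inl h0)) hmin
  · simp [ballAvg, integral_undef hfi, hp0]

end
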